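/- Let m and r be integers with m ≥ 1 and r ≥ 2. Define f_i : ℝ → ℝ by f_i(x) = −(r/(r−1))^{2m−1} x^{2m} for 1 ≤ i ≤ r and f_i(x) = x^{2m} for r+1 ≤ i ≤ 2r+1. Then for every point (x_1,…,x_{2r+1}) ∈ ℝ^{2r+1} with all coordinates nonzero satisfying (r/(r−1))^{2m−1} Σ_{i=1}^{r} x_i^{2m} = Σ_{i=1}^{r+1} x_{r+i}^{2m}, the separable minimality equation holds: Σ_{j=1}^{2r+1} (f_j'(x_j))^{-(2m-2)/(2m-1)} f_j''(x_j) · Σ_{i≠j} (f_i'(x_i))^{2m/(2m-1)} = 0. Hence the separable hypersurface −(r/(r−1))^{2m−1} Σ_{i=1}^{r} x_i^{2m} + Σ_{i=1}^{r+1} x_{r+i}^{2m} = 0 in (ℝ^{2r+1}, ‖·‖_{2m}) is minimal. -/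

import Mathlib

/-- The real `(2m-1)`-th root of `y`: the unique real number `s` with `s^(2m-1) = y`.
For `y ≠ 0`, the fractional power `y^(p/(2m-1))` is interpreted as `(oddRoot m y)^p`. -/
noncomputable def oddRoot (m : ℕ) (y : ℝ) : ℝ :=
  Real.sign y * |y| ^ ((2 * (m : ℝ) - 1)⁻¹)

theorem oddRoot_pow {m : ℕ} (hm : 1 ≤ m) (s : ℝ) : oddRoot m (s ^ (2 * m - 1)) = s := by
  have hodd : Odd (2 * m - 1) := ⟨m - 1, by omega⟩
  have hcast : (2 * (m : ℝ) - 1) = ((2 * m - 1 : ℕ) : ℝ) := by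
    rw [Nat.cast_sub (by omega)]
    push_cast
    ring
  have hsign : Real.sign (s ^ (2 * m - 1)) = Real.sign s := by
    rcases lt_trichotomy s 0 with h | h | h
    · rw [Real.sign_of_neg h, Real.sign_of_neg (hodd.pow_neg h)]
    · rw [h, zero_pow (by omega)]
    · rw [Real.sign_of_pos h, Real.sign_of_pos (pow_pos h _)]
  rw [oddRoot, hsign, hcast, abs_pow, Real.pow_rpow_inv_natCast (abs_nonneg s) (by omega)]
  rcases lt_trichotomy s 0 with h | h | h
  · rw [Real.sign_of_neg h, abs_of_neg h]
    ring
  · simp [h]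
  · rw [Real.sign_of_pos h, abs_of_pos h, one_mul]

theorem deriv_const_mul_pow (c : ℝ) (n : ℕ) :
    deriv (fun t : ℝ => c * t ^ n) = fun t => c * n * t ^ (n - 1) := by
  funext t
  rw [((hasDerivAt_pow n t).const_mul c).deriv]
  ring

/-- If `f_i(t) = γ_i^(2m-1) t^(2m)`, the separable minimality expression is a constant multiple of
`∑ j, γ_j * ∑ i ≠ j, (γ_i x_i)^(2m)`, hence vanishes when `hzero` holds. -/
theorem minimality_sum_eq_zero {ι : Type*} [Fintype ι] [DecidableEq ι] {m : ℕ} (hm : 1 ≤ m)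
    (γ x : ι → ℝ) (hγ : ∀ i, γ i ≠ 0) (hx : ∀ i, x i ≠ 0) (f : ι → ℝ → ℝ)
    (hf : ∀ i, f i = fun t => γ i ^ (2 * m - 1) * t ^ (2 * m))
    (hzero : (∑ j, γ j) * ∑ i, (γ i * x i) ^ (2 * m) = ∑ j, γ j * (γ j * x j) ^ (2 * m)) :
    ∑ j, ((oddRoot m (deriv (f j) (x j))) ^ (2 * m - 2))⁻¹
        * deriv (deriv (f j)) (x j)
        * ∑ i ∈ Finset.univ.erase j, (oddRoot m (deriv (f i) (x i))) ^ (2 * m) = 0 := by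
  obtain ⟨κ, hκ, hκm⟩ : ∃ κ : ℝ, κ ≠ 0 ∧ κ ^ (2 * m - 1) = ((2 * m : ℕ) : ℝ) :=
    ⟨((2 * m : ℕ) : ℝ) ^ ((2 * m - 1 : ℕ) : ℝ)⁻¹,
      (Real.rpow_pos_of_pos (by exact_mod_cast (by omega : 0 < 2 * m)) _).ne',
      Real.rpow_inv_natCast_pow (Nat.cast_nonneg _) (by omega)⟩
  have hroot (i : ι) : oddRoot m (deriv (f i) (x i)) = κ * (γ i * x i) := by
    rw [hf, deriv_const_mul_pow, ← hκm, ← oddRoot_pow hm (κ * (γ i * x i))]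
    ring_nf
  have hderiv (j : ι) : ((κ * (γ j * x j)) ^ (2 * m - 2))⁻¹ * deriv (deriv (f j)) (x j)
      = (κ ^ (2 * m - 2))⁻¹ * (2 * m : ℕ) * (2 * m - 1 : ℕ) * γ j := by
    rw [hf, deriv_const_mul_pow, deriv_const_mul_pow,
      show 2 * m - 1 - 1 = 2 * m - 2 by omega,
      show γ j ^ (2 * m - 1) = γ j ^ (2 * m - 2) * γ j by rw [← pow_succ]; congr 1; omega]
    have := hγ j
    have := hx j
    simp only [mul_pow]
    field_simp
  have hterm (j : ι) : ((κ * (γ j * x j)) ^ (2 * m - 2))⁻¹ * deriv (deriv (f j)) (x j)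
        * ∑ i ∈ Finset.univ.erase j, (κ * (γ i * x i)) ^ (2 * m)
      = (κ ^ (2 * m - 2))⁻¹ * (2 * m : ℕ) * (2 * m - 1 : ℕ) * κ ^ (2 * m)
        * (γ j * ∑ i, (γ i * x i) ^ (2 * m) - γ j * (γ j * x j) ^ (2 * m)) := by
    rw [hderiv, ← Finset.add_sum_erase _ (fun i => (γ i * x i) ^ (2 * m)) (Finset.mem_univ j)]
    simp_rw [mul_pow κ, ← Finset.mul_sum]
    ring
  simp_rw [hroot, hterm]
  rw [← Finset.mul_sum, Finset.sum_sub_distrib, ← Finset.sum_mul, hzero, sub_self, mul_zero]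

theorem sum_fin_ite_lt (r : ℕ) (a b : ℝ) :
    ∑ i : Fin (2 * r + 1), (if (i : ℕ) < r then a else b) = r * a + (r + 1) * b := by
  rw [Fin.sum_univ_eq_sum_range (fun i => if i < r then a else b),
    show 2 * r + 1 = r + (r + 1) by ring, Finset.sum_range_add,
    Finset.sum_congr rfl (fun i hi => if_pos (Finset.mem_range.1 hi))]
  simp

theorem sum_ite_mul_eq {ι : Type*} [Fintype ι] (k : ι → ℕ) (r : ℕ) (a b : ℝ) (y : ι → ℝ) :
    ∑ i, (if k i < r then a else b) * y i
      = a * ∑ i, (if k i < r then y i else 0) + b * ∑ i, (if r ≤ k i then y i else 0) := by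
  rw [Finset.mul_sum, Finset.mul_sum, ← Finset.sum_add_distrib]
  refine Finset.sum_congr rfl fun i _ => ?_
  by_cases h : k i < r
  · simp [h, not_le.2 h]
  · simp [h, not_lt.1 h]

/-- Example 6.4: the separable hypersurface
`-(r/(r-1))^{2m-1} Σ_{i=1}^{r} x_i^{2m} + Σ_{i=1}^{r+1} x_{r+i}^{2m} = 0` in
`(ℝ^{2r+1}, ‖·‖_{2m})` satisfies the separable minimality equation (6.1) at
every point with all coordinates nonzero; hence it is minimal. -/
theorem example_6_4_minimal (m r : ℕ) (hm : 1 ≤ m) (hr : 2 ≤ r)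
    (f : Fin (2 * r + 1) → ℝ → ℝ)
    (hf : ∀ i, ∀ t : ℝ, f i t
      = if (i : ℕ) < r then -((r : ℝ) / ((r : ℝ) - 1)) ^ (2 * m - 1) * t ^ (2 * m)
        else t ^ (2 * m))
    (x : Fin (2 * r + 1) → ℝ) (hx : ∀ i, x i ≠ 0)
    (hsum : ((r : ℝ) / ((r : ℝ) - 1)) ^ (2 * m - 1)
          * ∑ i : Fin (2 * r + 1), (if (i : ℕ) < r then (x i) ^ (2 * m) else (0 : ℝ))
        = ∑ i : Fin (2 * r + 1), (if r ≤ (i : ℕ) then (x i) ^ (2 * m) else (0 : ℝ))) :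
    ∑ j, ((oddRoot m (deriv (f j) (x j))) ^ (2 * m - 2))⁻¹
        * deriv (deriv (f j)) (x j)
        * ∑ i ∈ Finset.univ.erase j, (oddRoot m (deriv (f i) (x i))) ^ (2 * m) = 0 := by
  have hr0 : (r : ℝ) ≠ 0 := by positivity
  have hr1 : (r : ℝ) - 1 ≠ 0 := by
    have : (2 : ℝ) ≤ r := by exact_mod_cast hr
    linarith
  set ρ : ℝ := (r : ℝ) / ((r : ℝ) - 1)
  have hρr : ρ * ((r : ℝ) - 1) = r := div_mul_cancel₀ _ hr1
  have hρ0 : ρ ≠ 0 := div_ne_zero hr0 hr1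
  refine minimality_sum_eq_zero hm (fun i : Fin (2 * r + 1) => if (i : ℕ) < r then -ρ else 1) x
    (fun i => ?_) hx f (fun i => ?_) ?_
  · split_ifs <;> simp [hρ0]
  · funext t
    rw [hf]
    split_ifs
    · rw [Odd.neg_pow ⟨m - 1, by omega⟩]
    · rw [one_pow, one_mul]
  · have hpow (i : Fin (2 * r + 1)) : ((if (i : ℕ) < r then -ρ else 1) * x i) ^ (2 * m)
        = (if (i : ℕ) < r then ρ ^ (2 * m) else 1) * x i ^ (2 * m) := by
      split_ifs
      · rw [mul_pow, (even_two_mul m).neg_pow]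
      · simp
    have hpow' (i : Fin (2 * r + 1)) : (if (i : ℕ) < r then -ρ else 1)
          * ((if (i : ℕ) < r then ρ ^ (2 * m) else 1) * x i ^ (2 * m))
        = (if (i : ℕ) < r then -ρ * ρ ^ (2 * m) else 1) * x i ^ (2 * m) := by
      split_ifs <;> ring
    have hsucc : ρ ^ (2 * m) = ρ * ρ ^ (2 * m - 1) := by
      rw [← pow_succ']
      congr 1
      omega
    simp_rw [hpow, hpow', sum_fin_ite_lt, sum_ite_mul_eq]
    rw [← hsum, hsucc]
    set A := ∑ i : Fin (2 * r + 1), (if (i : ℕ) < r then (x i) ^ (2 * m) else (0 : ℝ))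
    linear_combination (-(ρ + 1) * ρ ^ (2 * m - 1) * A) * hρr
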